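/- Let d ≥ 1 and n ≥ 1 be integers. For any three pairwise distinct points x, y, z ∈ ℝ^d and any coordinate index 1 ≤ i ≤ d one has p^i_{1,n}(x,y,z) ≥ 0; moreover p^i_{1,n}(x,y,z) = 0 if and only if x, y, z are collinear or x_i = y_i = z_i. -/

import Mathlib

open scoped BigOperators

/-- The kernel `K^i_{α,n}(x) = x_i^{2n-1} / |x|^{2n-1+α}`. -/
noncomputable def Kker (d n : ℕ) (α : ℝ) (i : Fin d) (x : EuclideanSpace ℝ (Fin d)) : ℝ :=
  (x i) ^ (2 * n - 1) / ‖x‖ ^ (2 * (n : ℝ) - 1 + α)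

/-- The symmetrization (permutation) `p^i_{α,n}(x,y,z)`. -/
noncomputable def permI (d n : ℕ) (α : ℝ) (i : Fin d)
    (x y z : EuclideanSpace ℝ (Fin d)) : ℝ :=
  Kker d n α i (x - y) * Kker d n α i (x - z) +
    Kker d n α i (y - x) * Kker d n α i (y - z) +
    Kker d n α i (z - x) * Kker d n α i (z - y)

/-- Radon's inequality for two terms. -/
theorem add_pow_succ_div_add_pow_le (m : ℕ) {a b r s : ℝ} (ha : 0 < a) (hb : 0 < b)
    (hr : 0 ≤ r) (hs : 0 ≤ s) :
    (r + s) ^ (m + 1) / (a + b) ^ m ≤ r ^ (m + 1) / a ^ m + s ^ (m + 1) / b ^ m := by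
  have hc : 0 < a + b := add_pos ha hb
  have h := (convexOn_pow (𝕜 := ℝ) (m + 1)).2 (Set.mem_Ici.2 (div_nonneg hr ha.le))
    (Set.mem_Ici.2 (div_nonneg hs hb.le)) (div_nonneg ha.le hc.le) (div_nonneg hb.le hc.le)
    (by field_simp)
  simp only [smul_eq_mul] at h
  have h' := mul_le_mul_of_nonneg_left h hc.le
  have e₁ : a / (a + b) * (r / a) + b / (a + b) * (s / b) = (r + s) / (a + b) := by
    field_simp
  have e₂ : (a + b) * ((r + s) / (a + b)) ^ (m + 1) = (r + s) ^ (m + 1) / (a + b) ^ m := by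
    rw [div_pow, pow_succ (a + b)]
    field_simp
  have e₃ : (a + b) * (a / (a + b) * (r / a) ^ (m + 1) + b / (a + b) * (s / b) ^ (m + 1)) =
      r ^ (m + 1) / a ^ m + s ^ (m + 1) / b ^ m := by
    rw [div_pow, div_pow, pow_succ a, pow_succ b]
    field_simp
  rwa [e₁, e₂, e₃] at h'

/-- Radon's inequality for norms is strict for vectors on different rays. -/
theorem norm_add_pow_succ_div_lt {E : Type*} [NormedAddCommGroup E] [NormedSpace ℝ E]
    [StrictConvexSpace ℝ E] (m : ℕ) {a b : ℝ} (ha : 0 < a) (hb : 0 < b) {u v : E}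
    (huv : ¬ SameRay ℝ u v) :
    ‖u + v‖ ^ (m + 1) / (a + b) ^ m < ‖u‖ ^ (m + 1) / a ^ m + ‖v‖ ^ (m + 1) / b ^ m := by
  refine lt_of_lt_of_le ?_
    (add_pow_succ_div_add_pow_le m ha hb (norm_nonneg u) (norm_nonneg v))
  have := norm_add_lt_of_not_sameRay huv
  gcongr

/-- Equality case of Radon's inequality for norms of proportional vectors. -/
theorem norm_add_pow_succ_div_eq {E : Type*} [NormedAddCommGroup E] [NormedSpace ℝ E]
    (m : ℕ) {a b : ℝ} (ha : 0 < a) (hb : 0 < b) {u v : E} (huv : b • u = a • v) :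
    ‖u + v‖ ^ (m + 1) / (a + b) ^ m = ‖u‖ ^ (m + 1) / a ^ m + ‖v‖ ^ (m + 1) / b ^ m := by
  obtain ⟨t, rfl⟩ : ∃ t, u = a • t := ⟨a⁻¹ • u, by rw [smul_inv_smul₀ ha.ne']⟩
  obtain rfl : v = b • t := by
    rw [smul_comm] at huv
    exact (smul_right_injective E ha.ne' huv).symm
  have hc : 0 < a + b := add_pos ha hb
  rw [← add_smul, norm_smul_of_nonneg ha.le, norm_smul_of_nonneg hb.le,
    norm_smul_of_nonneg hc.le]
  simp only [mul_pow, pow_succ a, pow_succ b, pow_succ (a + b)]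
  field_simp

theorem Kker_one_succ (d k : ℕ) (i : Fin d) (x : EuclideanSpace ℝ (Fin d)) :
    Kker d (k + 1) 1 i x = x i ^ (2 * k + 1) / ‖x‖ ^ (2 * k + 2) := by
  have h : 2 * ((k + 1 : ℕ) : ℝ) - 1 + 1 = ((2 * k + 2 : ℕ) : ℝ) := by push_cast; ring
  rw [Kker, h, Real.rpow_natCast]
  rfl

theorem Kker_one_succ_neg (d k : ℕ) (i : Fin d) (x : EuclideanSpace ℝ (Fin d)) :
    Kker d (k + 1) 1 i (-x) = -Kker d (k + 1) 1 i x := by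
  rw [Kker_one_succ, Kker_one_succ, norm_neg, PiLp.neg_apply, Odd.neg_pow ⟨k, rfl⟩, neg_div]

theorem permI_one_succ (d k : ℕ) (i : Fin d) (x y z : EuclideanSpace ℝ (Fin d)) :
    permI d (k + 1) 1 i x y z =
      Kker d (k + 1) 1 i (y - x) * Kker d (k + 1) 1 i (z - x) -
        Kker d (k + 1) 1 i (y - x) * Kker d (k + 1) 1 i (z - y) +
        Kker d (k + 1) 1 i (z - x) * Kker d (k + 1) 1 i (z - y) := by
  rw [permI, ← neg_sub y x, ← neg_sub z x, ← neg_sub z y]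
  simp only [Kker_one_succ_neg]
  ring

theorem permI_swap_left (d n : ℕ) (α : ℝ) (i : Fin d) (x y z : EuclideanSpace ℝ (Fin d)) :
    permI d n α i x y z = permI d n α i y x z := by
  simp only [permI]; ring

theorem permI_swap_right (d n : ℕ) (α : ℝ) (i : Fin d) (x y z : EuclideanSpace ℝ (Fin d)) :
    permI d n α i x y z = permI d n α i x z y := by
  simp only [permI]; ring

theorem Collinear.smul_sub_eq_smul_sub {d : ℕ} {x y z : EuclideanSpace ℝ (Fin d)}
    (h : Collinear ℝ ({x, y, z} : Set (EuclideanSpace ℝ (Fin d)))) (i : Fin d) :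
    (z i - y i) • (y - x) = (y i - x i) • (z - y) := by
  obtain ⟨v, hv⟩ := (collinear_iff_of_mem (p₀ := x) (by simp)).1 h
  obtain ⟨r, rfl⟩ := hv y (by simp)
  obtain ⟨q, rfl⟩ := hv z (by simp)
  ext j
  simp
  ring

theorem collinear_of_smul_sub_eq_smul_sub {E : Type*} [AddCommGroup E] [Module ℝ E]
    {x y z : E} {a b : ℝ} (ha : a ≠ 0) (h : b • (y - x) = a • (z - y)) :
    Collinear ℝ ({x, y, z} : Set E) := by
  refine (collinear_iff_of_mem (p₀ := y) (by simp)).2 ⟨y - x, ?_⟩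
  have hz : z = (a⁻¹ * b) • (y - x) + y := by
    rw [mul_smul, h, inv_smul_smul₀ ha, sub_add_cancel]
  rintro p (rfl | rfl | rfl)
  · exact ⟨-1, by simp⟩
  · exact ⟨0, by simp⟩
  · exact ⟨_, hz⟩

theorem SameRay.apply_smul_eq_apply_smul {d : ℕ} {u v : EuclideanSpace ℝ (Fin d)}
    (h : SameRay ℝ u v) (i : Fin d) : v i • u = u i • v := by
  obtain ⟨w, a, b, -, -, -, rfl, rfl⟩ := h.exists_eq_smul
  ext j
  simp
  ring

/-- The main theorem for points ordered by their `i`-th coordinate. -/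
theorem permI_one_succ_of_le (d k : ℕ) (i : Fin d) {x y z : EuclideanSpace ℝ (Fin d)}
    (hxy : x ≠ y) (hyz : y ≠ z) (hxz : x ≠ z) (hxyi : x i ≤ y i) (hyzi : y i ≤ z i) :
    0 ≤ permI d (k + 1) 1 i x y z ∧
      (permI d (k + 1) 1 i x y z = 0 ↔
        Collinear ℝ ({x, y, z} : Set (EuclideanSpace ℝ (Fin d))) ∨
          (x i = y i ∧ y i = z i)) := by
  have hu : 0 < ‖y - x‖ := norm_pos_iff.2 (sub_ne_zero.2 hxy.symm)
  have hv : 0 < ‖z - y‖ := norm_pos_iff.2 (sub_ne_zero.2 hyz.symm)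
  have hw : 0 < ‖z - x‖ := norm_pos_iff.2 (sub_ne_zero.2 hxz.symm)
  rw [permI_one_succ]
  simp only [Kker_one_succ, PiLp.sub_apply]
  rcases hxyi.eq_or_lt with ha | ha
  · have hb : 0 ≤ z i - y i := sub_nonneg.2 hyzi
    simp only [ha, sub_self, ne_eq, Nat.add_eq_zero_iff, one_ne_zero, and_false,
      not_false_eq_true, zero_pow, zero_div, zero_mul, zero_add, true_and]
    refine ⟨by positivity, fun h ↦ Or.inr ?_, ?_⟩
    · by_contra hne
      have : 0 < z i - y i := sub_pos.2 (hyzi.lt_of_ne hne)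
      exact h.not_gt (by positivity)
    · intro h
      have hb0 : z i - y i = 0 := by
        rcases h with h | h
        · have := h.smul_sub_eq_smul_sub i
          rw [ha, sub_self, zero_smul, smul_eq_zero] at this
          exact this.resolve_right (sub_ne_zero.2 hxy.symm)
        · rw [h, sub_self]
      simp [hb0]
  rcases hyzi.eq_or_lt with hb | hb
  · have ha' : 0 < y i - x i := sub_pos.2 ha
    simp only [← hb, sub_self, ne_eq, Nat.add_eq_zero_iff, one_ne_zero, and_false,
      not_false_eq_true, zero_pow, zero_div, mul_zero, sub_zero, add_zero, and_true]
    refine ⟨by positivity, fun h ↦ absurd h (by positivity), ?_⟩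
    rintro (h | h)
    · have := h.smul_sub_eq_smul_sub i
      rw [← hb, sub_self, zero_smul, eq_comm, smul_eq_zero] at this
      exact absurd this (not_or.2 ⟨ha'.ne', sub_ne_zero.2 hyz.symm⟩)
    · exact absurd h ha.ne
  have ha' : 0 < y i - x i := sub_pos.2 ha
  have hb' : 0 < z i - y i := sub_pos.2 hb
  have hsum : z - x = (y - x) + (z - y) := by abel
  have hsumi : z i - x i = (y i - x i) + (z i - y i) := by ring
  have hlt : ¬ SameRay ℝ (y - x) (z - y) → _ :=
    norm_add_pow_succ_div_lt (2 * k + 1) ha' hb'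
  have heq := norm_add_pow_succ_div_eq (2 * k + 1) ha' hb' (u := y - x) (v := z - y)
  rw [← hsum, ← hsumi] at hlt heq
  have hc' : 0 < z i - x i := by linarith
  have hcol : Collinear ℝ ({x, y, z} : Set (EuclideanSpace ℝ (Fin d))) ↔
      (z i - y i) • (y - x) = (y i - x i) • (z - y) :=
    ⟨fun h ↦ h.smul_sub_eq_smul_sub i, collinear_of_smul_sub_eq_smul_sub ha'.ne'⟩
  simp only [ha.ne, false_and, or_false, hcol]
  have hray : SameRay ℝ (y - x) (z - y) →
      (z i - y i) • (y - x) = (y i - x i) • (z - y) :=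
    fun h ↦ h.apply_smul_eq_apply_smul i
  generalize y i - x i = a at *
  generalize z i - y i = b at *
  generalize z i - x i = c at *
  have hfactor : ∀ {a b c A B C : ℝ}, 0 < a → 0 < b → 0 < c → 0 < A → 0 < B → 0 < C →
      a / A * (c / C) - a / A * (b / B) + c / C * (b / B) =
        (A / a + B / b - C / c) * (a * b * c / (A * B * C)) := by
    intro a b c A B C _ _ _ _ _ _
    field_simp
    ring
  rw [hfactor (by positivity) (by positivity) (by positivity) (by positivity)
    (by positivity) (by positivity)]
  have hpos : 0 < a ^ (2 * k + 1) * b ^ (2 * k + 1) * c ^ (2 * k + 1) /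
      (‖y - x‖ ^ (2 * k + 2) * ‖z - y‖ ^ (2 * k + 2) * ‖z - x‖ ^ (2 * k + 2)) := by
    positivity
  by_cases h : b • (y - x) = a • (z - y)
  · have h0 := sub_eq_zero.2 (heq h).symm
    simp only [h, iff_true]
    rw [h0, zero_mul]
    exact ⟨le_rfl, rfl⟩
  · have h0 := mul_pos (sub_pos.2 (hlt (mt hray h))) hpos
    exact ⟨h0.le, iff_of_false h0.ne' h⟩

/-- For `α = 1`: `p^i_{1,n}(x,y,z) ≥ 0`, with equality if and only if `x, y, z` are
collinear or `x_i = y_i = z_i`. -/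
theorem stmt2 (d n : ℕ) (hd : 1 ≤ d) (hn : 1 ≤ n)
    (x y z : EuclideanSpace ℝ (Fin d)) (i : Fin d)
    (hxy : x ≠ y) (hyz : y ≠ z) (hxz : x ≠ z) :
    0 ≤ permI d n 1 i x y z ∧
      (permI d n 1 i x y z = 0 ↔
        Collinear ℝ ({x, y, z} : Set (EuclideanSpace ℝ (Fin d))) ∨
          (x i = y i ∧ y i = z i)) := by
  obtain ⟨k, rfl⟩ := Nat.exists_eq_add_of_le' hn
  suffices key : ∀ x y z : EuclideanSpace ℝ (Fin d), x ≠ y → y ≠ z → x ≠ z → x i ≤ y i →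
      0 ≤ permI d (k + 1) 1 i x y z ∧
        (permI d (k + 1) 1 i x y z = 0 ↔
          Collinear ℝ ({x, y, z} : Set (EuclideanSpace ℝ (Fin d))) ∨
            (x i = y i ∧ y i = z i)) by
    rcases le_total (x i) (y i) with h | h
    · exact key x y z hxy hyz hxz h
    · rw [permI_swap_left, Set.insert_comm,
        show (x i = y i ∧ y i = z i) ↔ (y i = x i ∧ x i = z i) by grind]
      exact key y x z hxy.symm hxz hyz h
  intro x y z hxy hyz hxz h
  rcases le_total (y i) (z i) with h₁ | h₁
  · exact permI_one_succ_of_le d k i hxy hyz hxz h h₁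
  rw [permI_swap_right, Set.pair_comm]
  rcases le_total (x i) (z i) with h₂ | h₂
  · rw [show (x i = y i ∧ y i = z i) ↔ (x i = z i ∧ z i = y i) by grind]
    exact permI_one_succ_of_le d k i hxz hyz.symm hxy h₂ h₁
  · rw [permI_swap_left, Set.insert_comm,
      show (x i = y i ∧ y i = z i) ↔ (z i = x i ∧ x i = y i) by grind]
    exact permI_one_succ_of_le d k i hxz.symm hxy hyz.symm h₂ h
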